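/- arXiv:math/9807113 — 2 statements merged into one kernel-verified Lean document; each statement's English description precedes it below -/
import Mathlib

section
/- Let M be a self-projective left R-module and S := End(_RM) its endomorphism ring. Then M has finite hollow dimension if and only if S is a semilocal ring, and in this case hdim(_RM) = hdim(_SS) = length(S/Jac(S)). -/
universe u v w

section Defs

variable (R : Type u) [Ring R] (M : Type v) [AddCommGroup M] [Module R M]

/-- `N` is a small (superfluous) submodule of `M`: `N + L = M` implies `L = M`. -/
def IsSmallSubmodule (N : Submodule R M) : Prop :=
  ∀ L : Submodule R M, N ⊔ L = ⊤ → L = ⊤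

/-- `N` is small in the submodule `T` (lattice-theoretic version). -/
def IsSmallInSubmodule (T N : Submodule R M) : Prop :=
  ∀ X : Submodule R M, X ≤ T → N ⊔ X = T → X = T

/-- `L` is a weak supplement of `N` in `M`. -/
def IsWeakSupplement (N L : Submodule R M) : Prop :=
  N ⊔ L = ⊤ ∧ IsSmallSubmodule R M (N ⊓ L)

/-- `M` is weakly supplemented. -/
def WeaklySupplemented : Prop :=
  ∀ N : Submodule R M, ∃ L : Submodule R M, IsWeakSupplement R M N L

/-- The radical of `M`: the intersection of all maximal submodules. -/
def moduleRad : Submodule R M :=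
  sInf {N : Submodule R M | IsCoatom N}

/-- `M` is a semilocal module: `M / Rad M` is semisimple. -/
def IsSemilocalModule : Prop :=
  IsSemisimpleModule R (M ⧸ moduleRad R M)

/-- `M` is hollow: nonzero and every proper submodule is small. -/
def IsHollowModule : Prop :=
  Nontrivial M ∧ ∀ N : Submodule R M, N ≠ ⊤ → IsSmallSubmodule R M N

/-- `N` is an essential submodule of `M`. -/
def IsEssentialSubmodule (N : Submodule R M) : Prop :=
  ∀ K : Submodule R M, K ≠ ⊥ → N ⊓ K ≠ ⊥

/-- A witness that `M` has hollow dimension `n`: a small-kernel epimorphism onto a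
direct sum of `n` hollow modules. -/
structure HollowDimWitness (n : ℕ) where
  H : Fin n → Type v
  [hAdd : ∀ i, AddCommGroup (H i)]
  [hMod : ∀ i, Module R (H i)]
  g : M →ₗ[R] ∀ i, H i
  surj : Function.Surjective g
  hollow : ∀ i, IsHollowModule R (H i)
  small : IsSmallSubmodule R M (LinearMap.ker g)

/-- `M` has finite hollow dimension. -/
def HasFiniteHollowDim : Prop := ∃ n : ℕ, Nonempty (HollowDimWitness R M n)

/-- The composition length of `M` is `n`. -/
def ModuleLengthIs (n : ℕ) : Prop :=
  ∃ s : CompositionSeries (Submodule R M), s.head = ⊥ ∧ s.last = ⊤ ∧ s.length = n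

/-- A family of proper submodules is coindependent. -/
def Coindependent {ι : Type w} (K : ι → Submodule R M) : Prop :=
  (∀ i, K i ≠ ⊤) ∧
    ∀ (i : ι) (J : Finset ι), i ∉ J → K i ⊔ (⨅ j ∈ J, K j) = ⊤

end Defs

/-- `M` is self-projective (quasi-projective): every homomorphism `M → M/N` lifts
to an endomorphism of `M`. -/
def SelfProjective (R : Type u) [Ring R] (M : Type v) [AddCommGroup M]
    [Module R M] : Prop :=
  ∀ (N : Submodule R M) (g : M →ₗ[R] M ⧸ N), ∃ h : M →ₗ[R] M, N.mkQ.comp h = g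


section ModuleTheory

variable {R : Type u} [Ring R] {M : Type v} [AddCommGroup M] [Module R M]

/-- Elementwise coindependence. -/
def CoInd {ι : Type w} (K : ι → Submodule R M) : Prop :=
  (∀ i, K i ≠ ⊤) ∧ ∀ i m, ∃ u, m - u ∈ K i ∧ ∀ j, j ≠ i → u ∈ K j

/-- `M / K` is hollow (or zero). -/
def HollowAt (K : Submodule R M) : Prop :=
  ∀ X Y : Submodule R M, K ≤ X → K ≤ Y → X ⊔ Y = ⊤ → X = ⊤ ∨ Y = ⊤

variable (R M) in
def CN (n : ℕ) : Prop := ∃ K : Fin n → Submodule R M, CoInd K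

theorem CoInd.comp_inj {ι : Type*} {κ : Type*} {K : ι → Submodule R M} (h : CoInd K)
    (f : κ → ι) (hf : Function.Injective f) : CoInd (fun j => K (f j)) := by
  refine ⟨fun j => h.1 _, fun j m => ?_⟩
  obtain ⟨u, h1, h2⟩ := h.2 (f j) m
  exact ⟨u, h1, fun l hl => h2 _ (fun e => hl (hf e))⟩

theorem CoInd.mono {ι : Type*} {K K' : ι → Submodule R M} (h : CoInd K)
    (hle : ∀ i, K i ≤ K' i) (hp : ∀ i, K' i ≠ ⊤) : CoInd K' := by
  refine ⟨hp, fun i m => ?_⟩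
  obtain ⟨u, h1, h2⟩ := h.2 i m
  exact ⟨u, hle _ h1, fun l hl => hle _ (h2 _ hl)⟩

theorem CN.anti {n m : ℕ} (h : n ≤ m) (hm : CN R M m) : CN R M n := by
  obtain ⟨K, hK⟩ := hm
  exact ⟨_, hK.comp_inj (Fin.castLE h) (Fin.castLE_injective h)⟩

theorem CoInd.toCN_succ {n : ℕ} {K : Option (Fin n) → Submodule R M} (h : CoInd K) :
    CN R M (n + 1) :=
  ⟨_, h.comp_inj (finSuccEquiv n) (finSuccEquiv n).injective⟩

theorem small_of_max {n : ℕ} {K : Fin n → Submodule R M} (h : CoInd K)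
    (hn : ¬ CN R M (n + 1)) : IsSmallSubmodule R M (⨅ i, K i) := by
  intro Z hZ
  by_contra hne
  apply hn
  have hdec : ∀ m : M, ∃ k ∈ (⨅ i, K i), ∃ z ∈ Z, k + z = m := fun m =>
    Submodule.mem_sup.1 (hZ ▸ Submodule.mem_top)
  refine CoInd.toCN_succ (K := fun o => o.elim Z K) ⟨?_, ?_⟩
  · rintro (_ | i)
    · exact hne
    · exact h.1 i
  · rintro (_ | i) m
    · obtain ⟨k, hk, z, hz, rfl⟩ := hdec m
      refine ⟨k, by simpa using hz, ?_⟩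
      rintro (_ | j) hj
      · exact absurd rfl hj
      · exact (Submodule.mem_iInf _).1 hk j
    · obtain ⟨u, h1, h2⟩ := h.2 i m
      obtain ⟨k, hk, z, hz, rfl⟩ := hdec u
      rw [Submodule.mem_iInf] at hk
      refine ⟨z, ?_, ?_⟩
      · have := (K i).add_mem h1 (hk i)
        have e : m - (k + z) + k = m - z := by abel
        rwa [e] at this
      · rintro (_ | j) hj
        · exact hz
        · have := (K j).sub_mem (h2 j (fun e => hj (by rw [e]))) (hk j)
          simpa using this

theorem hollow_of_max {n : ℕ} {K : Fin n → Submodule R M} (h : CoInd K)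
    (hn : ¬ CN R M (n + 1)) (i : Fin n) : HollowAt (K i) := by
  intro X Y hX hY hXY
  by_contra hne
  push Not at hne
  apply hn
  have hdec : ∀ m : M, ∃ x ∈ X, ∃ y ∈ Y, x + y = m := fun m =>
    Submodule.mem_sup.1 (hXY ▸ Submodule.mem_top)
  refine CoInd.toCN_succ (K := fun o => o.elim X (Function.update K i Y)) ⟨?_, ?_⟩
  · rintro (_ | j)
    · exact hne.1
    · by_cases hj : j = i
      · subst hj; simpa using hne.2
      · simpa [hj] using h.1 j
  · rintro (_ | j) m
    · obtain ⟨x, hx, y, hy, rfl⟩ := hdec m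
      obtain ⟨u, h1, h2⟩ := h.2 i y
      refine ⟨u, ?_, ?_⟩
      · have := X.add_mem hx (hX h1)
        simpa [add_sub_assoc] using this
      · rintro (_ | l) hl
        · exact absurd rfl hl
        · by_cases hli : l = i
          · subst hli
            have := Y.sub_mem hy (hY h1)
            simpa using this
          · simpa [hli] using h2 l hli
    · by_cases hj : j = i
      · subst hj
        obtain ⟨x, hx, y, hy, rfl⟩ := hdec m
        obtain ⟨u, h1, h2⟩ := h.2 j x
        refine ⟨u, ?_, ?_⟩
        · have := Y.add_mem hy (hY h1)
          have e : x + y - u = y + (x - u) := by abel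
          simpa [e] using this
        · rintro (_ | l) hl
          · have := X.sub_mem hx (hX h1)
            simpa using this
          · have hlj : l ≠ j := fun e => hl (by rw [e])
            simpa [hlj] using h2 l hlj
      · obtain ⟨u, h1, h2⟩ := h.2 j m
        refine ⟨u, by simpa [hj] using h1, ?_⟩
        rintro (_ | l) hl
        · exact hX (h2 i (Ne.symm hj))
        · have hlj : l ≠ j := fun e => hl (by rw [e])
          by_cases hli : l = i
          · subst hli
            simpa using hY (h2 l hlj)
          · simpa [hli] using h2 l hlj

/-- Each piece is small. -/
theorem small_piece {n : ℕ} {K : Fin n → Submodule R M} (h : CoInd K)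
    (hh : ∀ i, HollowAt (K i)) (hs : IsSmallSubmodule R M (⨅ i, K i))
    (X : Submodule R M) (i : Fin n) (hX : X ⊔ K i ≠ ⊤) :
    IsSmallSubmodule R M ((X ⊔ K i) ⊓ ⨅ j, ⨅ (_ : j ≠ i), K j) := by
  intro Z hZ
  set U : Submodule R M := ⨅ j, ⨅ (_ : j ≠ i), K j with hU
  have hmemU : ∀ u, u ∈ U ↔ ∀ j, j ≠ i → u ∈ K j := by
    intro u; simp [hU, Submodule.mem_iInf]
  have hdec : ∀ m : M, ∃ x ∈ (X ⊔ K i) ⊓ U, ∃ y ∈ Z, x + y = m := fun m =>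
    Submodule.mem_sup.1 (hZ ▸ Submodule.mem_top)
  have h1 : (X ⊔ K i) ⊔ ((U ⊓ Z) ⊔ K i) = ⊤ := by
    rw [eq_top_iff]
    intro m _
    obtain ⟨u, hu1, hu2⟩ := h.2 i m
    obtain ⟨x, hx, z, hz, rfl⟩ := hdec u
    have hzU : z ∈ U := by
      have := U.sub_mem ((hmemU _).2 hu2) hx.2
      simpa using this
    have e : m = x + (z + (m - (x + z))) := by abel
    rw [e]
    exact Submodule.add_mem_sup hx.1 (Submodule.add_mem_sup ⟨hzU, hz⟩ hu1)
  have h2 : (U ⊓ Z) ⊔ K i = ⊤ :=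
    (hh i _ _ le_sup_right le_sup_right h1).resolve_left hX
  apply hs
  rw [eq_top_iff]
  have h3 : U ≤ (⨅ i, K i) ⊔ Z := by
    intro u hu
    obtain ⟨z, hz, k, hk, rfl⟩ := Submodule.mem_sup.1 (h2 ▸ Submodule.mem_top : u ∈ (U ⊓ Z) ⊔ K i)
    rw [add_comm]
    refine Submodule.add_mem_sup ?_ hz.2
    rw [Submodule.mem_iInf]
    intro j
    by_cases hj : j = i
    · rw [hj]; exact hk
    · have := U.sub_mem hu hz.1
      rw [add_sub_cancel_left] at this
      exact (hmemU _).1 this j hj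
  rw [← hZ]
  exact sup_le (inf_le_right.trans h3) le_sup_right

theorem small_sup {A B : Submodule R M} (hA : IsSmallSubmodule R M A)
    (hB : IsSmallSubmodule R M B) : IsSmallSubmodule R M (A ⊔ B) := by
  intro L hL
  rw [sup_assoc] at hL
  exact hB _ (hA _ hL)

theorem small_mono {A B : Submodule R M} (hA : IsSmallSubmodule R M A)
    (hB : B ≤ A) : IsSmallSubmodule R M B := by
  intro L hL
  exact hA _ (top_le_iff.1 (hL ▸ sup_le_sup_right hB L))

theorem small_finset_sup {ι : Type*} (s : Finset ι) (A : ι → Submodule R M)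
    (hA : ∀ i ∈ s, IsSmallSubmodule R M (A i)) : IsSmallSubmodule R M (s.sup A) := by
  classical
  induction s using Finset.induction_on with
  | empty => intro L hL; simpa using hL
  | insert a s _ ih =>
    rw [Finset.sup_insert]
    exact small_sup (hA a (Finset.mem_insert_self _ _))
      (ih (fun i hi => hA i (Finset.mem_insert_of_mem hi)))

theorem small_of_all {n : ℕ} {K : Fin n → Submodule R M} (h : CoInd K)
    (hh : ∀ i, HollowAt (K i)) (hs : IsSmallSubmodule R M (⨅ i, K i))
    (X : Submodule R M) (hX : ∀ i, X ⊔ K i ≠ ⊤) : IsSmallSubmodule R M X := by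
  have h1 := small_sup (small_finset_sup Finset.univ _
    (fun i _ => small_piece h hh hs X i (hX i))) hs
  refine small_mono h1 ?_
  intro x hx
  choose u hu1 hu2 using fun i => h.2 i x
  have e : x = (∑ i, u i) + (x - ∑ i, u i) := by abel
  rw [e]
  refine Submodule.add_mem_sup ?_ ?_
  · refine Submodule.sum_mem _ fun i _ => ?_
    refine (Finset.le_sup (f := fun i => (X ⊔ K i) ⊓ ⨅ j, ⨅ (_ : j ≠ i), K j)
      (Finset.mem_univ i)) ⟨?_, ?_⟩
    · have : u i = x + -(x - u i) := by abel
      rw [this]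
      exact Submodule.add_mem_sup hx ((K i).neg_mem (hu1 i))
    · simpa [Submodule.mem_iInf] using hu2 i
  · rw [Submodule.mem_iInf]
    intro j
    rw [← Finset.add_sum_erase _ _ (Finset.mem_univ j), ← sub_sub]
    refine (K j).sub_mem (hu1 j) (Submodule.sum_mem _ fun i hi => ?_)
    exact hu2 i j (Finset.ne_of_mem_erase hi).symm

theorem exchange {n : ℕ} {K : Fin n → Submodule R M} (h : CoInd K)
    (hh : ∀ i, HollowAt (K i)) (hs : IsSmallSubmodule R M (⨅ i, K i))
    {m : ℕ} (V : Fin m → Submodule R M) (hV : CoInd V) (s : Finset (Fin m)) :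
    ∃ W : Fin m → Submodule R M, CoInd W ∧ ∀ j ∈ s, ∃ i, W j = K i := by
  induction s using Finset.induction_on with
  | empty => exact ⟨V, hV, by simp⟩
  | insert a s ha ih =>
    obtain ⟨W, hW, hWs⟩ := ih
    set X : Submodule R M := ⨅ j, ⨅ (_ : j ≠ a), W j with hXd
    have hmem : ∀ u, u ∈ X ↔ ∀ j, j ≠ a → u ∈ W j := by
      intro u; simp [hXd, Submodule.mem_iInf]
    have hXW : X ⊔ W a = ⊤ := by
      rw [eq_top_iff]
      intro m _
      obtain ⟨u, h1, h2⟩ := hW.2 a m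
      have e : m = u + (m - u) := by abel
      rw [e]
      exact Submodule.add_mem_sup ((hmem u).2 h2) h1
    have hex : ∃ i, X ⊔ K i = ⊤ := by
      by_contra hno
      push Not at hno
      exact hW.1 a (small_of_all h hh hs X hno _ hXW)
    obtain ⟨i, hi⟩ := hex
    refine ⟨Function.update W a (K i), ⟨?_, ?_⟩, ?_⟩
    · intro j
      by_cases hj : j = a
      · subst hj; simpa using h.1 i
      · simpa [hj] using hW.1 j
    · intro j m
      by_cases hj : j = a
      · subst hj
        obtain ⟨x, hx, k, hk, rfl⟩ := Submodule.mem_sup.1 (hi ▸ Submodule.mem_top : m ∈ X ⊔ K i)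
        refine ⟨x, by simpa using hk, fun l hl => ?_⟩
        simpa [hl] using (hmem x).1 hx l hl
      · obtain ⟨u, h1, h2⟩ := hW.2 j m
        obtain ⟨x, hx, k, hk, rfl⟩ := Submodule.mem_sup.1 (hi ▸ Submodule.mem_top : u ∈ X ⊔ K i)
        rw [hmem] at hx
        refine ⟨k, ?_, fun l hl => ?_⟩
        · have := (W j).add_mem h1 (hx j hj)
          have e : m - (x + k) + x = m - k := by abel
          rw [e] at this
          simpa [hj] using this
        · by_cases hla : l = a
          · subst hla; simpa using hk
          · have := (W l).sub_mem (h2 l hl) (hx l hla)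
            simpa [hla] using this
    · intro j hj
      by_cases hja : j = a
      · subst hja; exact ⟨i, by simp⟩
      · simpa [hja] using hWs j (Finset.mem_of_mem_insert_of_ne hj hja)

theorem CoInd.injective {ι : Type*} {W : ι → Submodule R M} (hW : CoInd W) :
    Function.Injective W := by
  intro a b hab
  by_contra hne
  apply hW.1 a
  rw [eq_top_iff]
  intro m _
  obtain ⟨u, h1, h2⟩ := hW.2 a m
  have h3 := h2 b (Ne.symm hne)
  rw [← hab] at h3
  simpa using (W a).add_mem h1 h3

theorem le_of_hollow {n : ℕ} {K : Fin n → Submodule R M} (h : CoInd K)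
    (hh : ∀ i, HollowAt (K i)) (hs : IsSmallSubmodule R M (⨅ i, K i))
    {m : ℕ} (hV : CN R M m) : m ≤ n := by
  obtain ⟨V, hV⟩ := hV
  obtain ⟨W, hW, hW2⟩ := exchange h hh hs V hV Finset.univ
  choose f hf using fun j => hW2 j (Finset.mem_univ j)
  have : Function.Injective f := by
    intro a b hab
    apply hW.injective
    rw [hf, hf, hab]
  simpa using Fintype.card_le_of_injective f this

variable (R M) in
/-- The data of a hollow dimension witness in terms of kernels. -/
def HK (n : ℕ) : Prop := ∃ K : Fin n → Submodule R M, CoInd K ∧ (∀ i, HollowAt (K i)) ∧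
  IsSmallSubmodule R M (⨅ i, K i)

theorem HK_iff (n : ℕ) : HK R M n ↔ CN R M n ∧ ¬ CN R M (n + 1) := by
  constructor
  · rintro ⟨K, h, hh, hs⟩
    refine ⟨⟨K, h⟩, fun hc => ?_⟩
    have := le_of_hollow h hh hs hc
    omega
  · rintro ⟨⟨K, h⟩, hn⟩
    exact ⟨K, h, hollow_of_max h hn, small_of_max h hn⟩

theorem CoInd.pi_surjective {n : ℕ} {K : Fin n → Submodule R M} (h : CoInd K) :
    Function.Surjective (LinearMap.pi fun i => (K i).mkQ) := by
  intro y
  choose m hm using fun i => (K i).mkQ_surjective (y i)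
  choose u hu1 hu2 using fun i => h.2 i (m i)
  refine ⟨∑ i, u i, ?_⟩
  ext j
  rw [LinearMap.pi_apply, map_sum, Finset.sum_eq_single j, ← hm j]
  · rw [Submodule.mkQ_apply, Submodule.mkQ_apply, eq_comm, Submodule.Quotient.eq]
    exact hu1 j
  · intro i _ hij
    rw [Submodule.mkQ_apply, Submodule.Quotient.mk_eq_zero]
    exact hu2 i j hij.symm
  · simp

theorem ker_pi_mkQ {n : ℕ} (K : Fin n → Submodule R M) :
    LinearMap.ker (LinearMap.pi fun i => (K i).mkQ) = ⨅ i, K i := by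
  rw [LinearMap.ker_pi]; simp

theorem HollowAt.isHollow {K : Submodule R M} (h : HollowAt K) (hK : K ≠ ⊤) :
    IsHollowModule R (M ⧸ K) := by
  refine ⟨Submodule.Quotient.nontrivial_iff.2 hK, fun N hN L hL => ?_⟩
  have hinj := Submodule.comap_injective_of_surjective K.mkQ_surjective
  have := h (N.comap K.mkQ) (L.comap K.mkQ) (Submodule.le_comap_mkQ _ _)
    (Submodule.le_comap_mkQ _ _) ?_
  · rcases this with h1 | h1
    · exact absurd (hinj (h1.trans (Submodule.comap_top _).symm)) hN
    · exact hinj (h1.trans (Submodule.comap_top _).symm)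
  · rw [eq_top_iff]
    intro m _
    obtain ⟨a, ha, b, hb, hab⟩ := Submodule.mem_sup.1 (hL ▸ Submodule.mem_top : K.mkQ m ∈ N ⊔ L)
    obtain ⟨a, rfl⟩ := K.mkQ_surjective a
    have e : m = a + (m - a) := by abel
    rw [e]
    refine Submodule.add_mem_sup ha ?_
    rw [Submodule.mem_comap, map_sub, ← hab, add_sub_cancel_left]
    exact hb

theorem witness_iff (n : ℕ) : Nonempty (HollowDimWitness R M n) ↔ HK R M n := by
  constructor
  · rintro ⟨⟨H, g, hsurj, hh, hs⟩⟩
    rename_i hAdd hMod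
    have hsj : ∀ i, Function.Surjective ((LinearMap.proj i).comp g : M →ₗ[R] H i) := by
      intro i
      exact (LinearMap.proj_surjective (R := R) (φ := H) i).comp hsurj
    refine ⟨fun i => LinearMap.ker ((LinearMap.proj i).comp g), ⟨fun i => ?_, fun i m => ?_⟩,
      fun i X Y hX hY hXY => ?_, ?_⟩
    · intro htop
      rw [LinearMap.ker_eq_top] at htop
      obtain ⟨y, hy⟩ := @exists_ne _ (hh i).1 (0 : H i)
      obtain ⟨m, hm⟩ := hsj i y
      rw [htop] at hm
      exact hy hm.symm
    · classical
      obtain ⟨u, hu⟩ := hsurj (Pi.single i (g m i))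
      refine ⟨u, ?_, fun j hj => ?_⟩
      · simp [hu]
      · simp [hu, hj]
    · set f : M →ₗ[R] H i := (LinearMap.proj i).comp g
      have key : ∀ X : Submodule R M, LinearMap.ker f ≤ X → X.map f = ⊤ → X = ⊤ := by
        intro X hX h
        have := Submodule.comap_map_eq f X
        rw [h, Submodule.comap_top, sup_eq_left.2 hX] at this
        exact this.symm
      by_cases hXt : X.map f = ⊤
      · exact Or.inl (key X hX hXt)
      · right
        apply key Y hY
        apply (hh i).2 _ hXt
        rw [← Submodule.map_sup, hXY, Submodule.map_top, LinearMap.range_eq_top]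
        exact hsj i
    · refine small_mono hs ?_
      intro x hx
      rw [Submodule.mem_iInf] at hx
      rw [LinearMap.mem_ker]
      ext i
      exact hx i
  · rintro ⟨K, h, hh, hs⟩
    exact ⟨{ H := fun i => M ⧸ K i
             g := LinearMap.pi fun i => (K i).mkQ
             surj := h.pi_surjective
             hollow := fun i => (hh i).isHollow (h.1 i)
             small := by rw [ker_pi_mkQ]; exact hs }⟩

end ModuleTheory

section SelfProj

open MulOpposite

variable {R : Type u} [Ring R] {M : Type v} [AddCommGroup M] [Module R M]

/-- Right ideals (as ideals of the opposite ring) contain every endomorphism whose range lies in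
the sum of ranges of finitely many members. -/
theorem mem_of_range_le (hM : SelfProjective R M) (I : Ideal (Module.End R M)ᵐᵒᵖ) {ι : Type*}
    (s : Finset ι) (f : ι → Module.End R M) (hf : ∀ i ∈ s, op (f i) ∈ I) :
    ∀ h : Module.End R M, LinearMap.range h ≤ s.sup (fun i => LinearMap.range (f i)) →
      op h ∈ I := by
  classical
  induction s using Finset.induction_on with
  | empty =>
    intro h hh
    have : h = 0 := LinearMap.range_eq_bot.1 (by simpa using hh)
    rw [this, op_zero]
    exact I.zero_mem
  | insert a s ha ih =>
    intro h hh
    rw [Finset.sup_insert] at hh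
    set A : Submodule R M := s.sup (fun i => LinearMap.range (f i)) with hA
    set φ : M →ₗ[R] M ⧸ A := A.mkQ.comp (f a) with hφ
    have hr : ∀ m, A.mkQ (h m) ∈ LinearMap.range φ := by
      intro m
      obtain ⟨_, ⟨x, rfl⟩, y, hy, hxy⟩ := Submodule.mem_sup.1 (hh ⟨m, rfl⟩)
      refine ⟨x, ?_⟩
      rw [← hxy, map_add]
      have : A.mkQ y = 0 := by simpa using hy
      rw [this, add_zero]
      rfl
    let ψ : M →ₗ[R] LinearMap.range φ := (A.mkQ.comp h).codRestrict _ hr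
    obtain ⟨g, hg⟩ := hM (LinearMap.ker φ) (φ.quotKerEquivRange.symm.toLinearMap.comp ψ)
    have hg2 : ∀ m, φ (g m) = A.mkQ (h m) := by
      intro m
      have h1 := LinearMap.congr_fun hg m
      have h2 := congrArg φ.quotKerEquivRange h1
      have h3 := congrArg Subtype.val h2
      simpa [ψ] using h3
    have h1 : op (h - f a * g) ∈ I := by
      apply ih (fun i hi => hf i (Finset.mem_insert_of_mem hi))
      rintro _ ⟨m, rfl⟩
      have := hg2 m
      rw [hφ, LinearMap.comp_apply, eq_comm, Submodule.mkQ_apply, Submodule.mkQ_apply,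
        Submodule.Quotient.eq] at this
      exact this
    have h2 : op (f a * g) ∈ I := by
      rw [op_mul]
      exact I.mul_mem_left _ (hf a (Finset.mem_insert_self _ _))
    have := I.add_mem h1 h2
    rwa [← op_add, sub_add_cancel] at this

theorem CN_op_of_CN (hM : SelfProjective R M) (n : ℕ) (h : CN R M n) :
    CN (Module.End R M)ᵐᵒᵖ (Module.End R M)ᵐᵒᵖ n := by
  obtain ⟨K, hK⟩ := h
  let I : Fin n → Ideal (Module.End R M)ᵐᵒᵖ := fun i =>
    { carrier := {a | ∀ m, (unop a) m ∈ K i}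
      add_mem' := fun {a b} ha hb m => (K i).add_mem (ha m) (hb m)
      zero_mem' := fun m => (K i).zero_mem
      smul_mem' := fun c a ha m => ha _ }
  have hI : ∀ i a, a ∈ I i ↔ ∀ m, (unop a) m ∈ K i := fun i a => Iff.rfl
  refine ⟨I, fun i htop => ?_, fun i a => ?_⟩
  · apply hK.1 i
    rw [eq_top_iff]
    intro m _
    exact (hI i 1).1 (htop ▸ Submodule.mem_top) m
  · set U : Submodule R M := ⨅ j, ⨅ (_ : j ≠ i), K j with hU
    have hmem : ∀ u, u ∈ U ↔ ∀ j, j ≠ i → u ∈ K j := by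
      intro u; simp [hU, Submodule.mem_iInf]
    let φ : M →ₗ[R] (M ⧸ K i) × (M ⧸ U) := (K i).mkQ.prod U.mkQ
    have hφ : Function.Surjective φ := by
      rintro ⟨x, y⟩
      obtain ⟨x, rfl⟩ := (K i).mkQ_surjective x
      obtain ⟨y, rfl⟩ := U.mkQ_surjective y
      obtain ⟨u, h1, h2⟩ := hK.2 i (x - y)
      refine ⟨y + u, ?_⟩
      refine Prod.ext ?_ ?_
      · change (K i).mkQ (y + u) = (K i).mkQ x
        rw [Submodule.mkQ_apply, Submodule.mkQ_apply, eq_comm, Submodule.Quotient.eq]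
        rwa [← sub_sub]
      · change U.mkQ (y + u) = U.mkQ y
        rw [Submodule.mkQ_apply, Submodule.mkQ_apply, Submodule.Quotient.eq, add_sub_cancel_left]
        exact (hmem u).2 h2
    obtain ⟨b, hb⟩ := hM (LinearMap.ker φ)
      ((φ.quotKerEquivOfSurjective hφ).symm.toLinearMap.comp ((K i).mkQ.prod 0))
    have hb2 : ∀ m, φ (b m) = ((K i).mkQ m, 0) := by
      intro m
      have h1 := LinearMap.congr_fun hb m
      have h2 := congrArg (φ.quotKerEquivOfSurjective hφ) h1
      simpa using h2
    refine ⟨op (b * unop a), ?_, fun j hj => ?_⟩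
    · rw [hI]
      intro m
      have := congrArg Prod.fst (hb2 (unop a m))
      change (K i).mkQ (b (unop a m)) = (K i).mkQ (unop a m) at this
      rw [eq_comm, Submodule.mkQ_apply, Submodule.mkQ_apply, Submodule.Quotient.eq] at this
      exact this
    · rw [hI]
      intro m
      have := congrArg Prod.snd (hb2 (unop a m))
      change U.mkQ (b (unop a m)) = 0 at this
      rw [Submodule.mkQ_apply, Submodule.Quotient.mk_eq_zero] at this
      exact (hmem _).1 this j hj

theorem CN_of_CN_op (hM : SelfProjective R M) (n : ℕ)
    (h : CN (Module.End R M)ᵐᵒᵖ (Module.End R M)ᵐᵒᵖ n) : CN R M n := by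
  obtain ⟨I, hI⟩ := h
  choose b hb1 hb2 using fun i => hI.2 i 1
  let c : Fin n → Fin n → Module.End R M := fun i j => if j = i then 1 - unop (b i) else unop (b j)
  have hc : ∀ i j, op (c i j) ∈ I i := by
    intro i j
    by_cases hj : j = i
    · simpa [c, hj] using hb1 i
    · simpa [c, hj] using hb2 j i (Ne.symm hj)
  refine ⟨fun i => Finset.univ.sup (fun j => LinearMap.range (c i j)), fun i htop => ?_,
    fun i m => ?_⟩
  · apply hI.1 i
    rw [Ideal.eq_top_iff_one]
    exact mem_of_range_le hM (I i) Finset.univ (c i) (fun j _ => hc i j) 1 (le_top.trans (le_of_eq htop.symm))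
  · refine ⟨unop (b i) m, ?_, fun j hj => ?_⟩
    · refine (Finset.le_sup (f := fun j => LinearMap.range (c i j)) (Finset.mem_univ i)) ⟨m, ?_⟩
      simp [c]
    · refine (Finset.le_sup (f := fun l => LinearMap.range (c j l)) (Finset.mem_univ i)) ⟨m, ?_⟩
      simp [c, Ne.symm hj]

theorem HK_iff_op (hM : SelfProjective R M) (n : ℕ) :
    HK R M n ↔ HK (Module.End R M)ᵐᵒᵖ (Module.End R M)ᵐᵒᵖ n := by
  have h : ∀ k, CN R M k ↔ CN (Module.End R M)ᵐᵒᵖ (Module.End R M)ᵐᵒᵖ k := fun k =>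
    ⟨CN_op_of_CN hM k, CN_of_CN_op hM k⟩
  rw [HK_iff, HK_iff, h, h]

end SelfProj

section Rings

open MulOpposite

/-- Two-sided description of the Jacobson radical. -/
def InJ {S : Type*} [Ring S] (x : S) : Prop := ∀ a b : S, IsUnit (1 + a * x * b)

theorem mem_moduleRad_iff {S : Type v} [Ring S] (x : S) : x ∈ moduleRad S S ↔ InJ x := by
  have hJ : moduleRad S S = Ring.jacobson S := rfl
  have hmem : ∀ x : S, x ∈ Ring.jacobson S ↔ ∀ y, ∃ z, z * y * x + z - 1 = 0 := by
    intro x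
    rw [← Ideal.jacobson_bot, Ideal.mem_jacobson_iff]
    simp
  have hleft : ∀ x ∈ Ring.jacobson S, ∃ z, z * (1 + x) = 1 := by
    intro x hx
    obtain ⟨z, hz⟩ := (hmem x).1 hx 1
    refine ⟨z, ?_⟩
    rw [mul_one] at hz
    rw [mul_add, mul_one, add_comm]
    exact sub_eq_zero.1 hz
  have hunit : ∀ x ∈ Ring.jacobson S, IsUnit (1 + x) := by
    intro x hx
    obtain ⟨z, hz⟩ := hleft x hx
    have hz2 : z = 1 + (-z * x) := by
      rw [mul_add, mul_one] at hz
      rw [neg_mul, ← hz]; abel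
    obtain ⟨w, hw⟩ := hleft _ ((Ring.jacobson S).mul_mem_left (-z) hx)
    rw [← hz2] at hw
    have hwx : w = 1 + x := by
      calc w = w * (z * (1 + x)) := by rw [hz, mul_one]
        _ = 1 + x := by rw [← mul_assoc, hw, one_mul]
    rw [hwx] at hw
    exact ⟨⟨1 + x, z, hw, hz⟩, rfl⟩
  rw [hJ]
  constructor
  · intro hx a b
    exact hunit _ (Ideal.mul_mem_right _ _ ((Ring.jacobson S).mul_mem_left a hx))
  · intro h
    rw [hmem]
    intro y
    obtain ⟨⟨_, z, h1, h2⟩, rfl⟩ := h y 1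
    refine ⟨z, ?_⟩
    simp only [mul_one] at h2
    rw [← h2]
    noncomm_ring

theorem InJ.op {S : Type*} [Ring S] {x : S} : InJ (op x) ↔ InJ x := by
  constructor
  · intro h a b
    have := (h (MulOpposite.op b) (MulOpposite.op a)).unop
    simpa [mul_assoc] using this
  · intro h a b
    have := (h (unop b) (unop a)).op
    simpa [mul_assoc] using this

structure DData {S T : Type v} [Ring S] [Ring T] {n : ℕ} (π : S →+* T) (e : Fin n → T) : Prop where
  surj : Function.Surjective π
  ker : ∀ s, π s = 0 ↔ InJ s
  ne : ∀ i, e i ≠ 0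
  idem : ∀ i, e i * e i = e i
  orth : ∀ i j, i ≠ j → e i * e j = 0
  sum : ∑ i, e i = 1
  semiprime : ∀ x : T, x ≠ 0 → ∃ y, x * y * x ≠ 0
  corner : ∀ i x, e i * x * e i ≠ 0 →
    ∃ y, e i * x * e i * y * e i = e i ∧ e i * y * e i * x * e i = e i

def DD (S : Type v) [Ring S] (n : ℕ) : Prop :=
  ∃ (T : Type v) (_ : Ring T) (π : S →+* T) (e : Fin n → T), DData π e

/-- Transfer along an anti-isomorphism. -/
theorem DD.anti {S S' : Type v} [Ring S] [Ring S'] (f : S' ≃+* Sᵐᵒᵖ) {n : ℕ} (h : DD S n) :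
    DD S' n := by
  obtain ⟨T, _, π, e, h⟩ := h
  have hInJ : ∀ s : S', InJ s ↔ InJ (f s) := by
    intro s
    constructor
    · intro h a b
      have := (h (f.symm a) (f.symm b)).map f
      simpa using this
    · intro h a b
      have := (h (f a) (f b)).map f.symm
      simpa using this
  refine ⟨Tᵐᵒᵖ, inferInstance, (RingHom.op π).comp (f : S' →+* Sᵐᵒᵖ), fun i => op (e i), ?_⟩
  constructor
  · intro t
    obtain ⟨s, hs⟩ := h.surj (unop t)
    refine ⟨f.symm (op s), ?_⟩
    simp [hs]
  · intro s
    rw [hInJ]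
    have h1 := h.ker (unop (f s))
    rw [← InJ.op, op_unop] at h1
    rw [← h1]
    simp
  · intro i; simpa using h.ne i
  · intro i; rw [← op_mul, h.idem]
  · intro i j hij; rw [← op_mul, h.orth j i hij.symm, op_zero]
  · rw [← Finset.op_sum, h.sum, op_one]
  · intro x hx
    obtain ⟨y, hy⟩ := h.semiprime (unop x) (by simpa using hx)
    refine ⟨op y, fun h0 => hy ?_⟩
    have := congrArg unop h0
    simpa [mul_assoc] using this
  · intro i x hx
    obtain ⟨y, hy1, hy2⟩ := h.corner i (unop x) (fun h0 => hx (by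
      apply unop_injective
      simpa [mul_assoc] using h0))
    refine ⟨op y, ?_, ?_⟩
    · apply unop_injective
      simpa [mul_assoc] using hy2
    · apply unop_injective
      simpa [mul_assoc] using hy1

theorem maximal_inv {S : Type v} [Ring S] {K : Ideal S} (hK : K.IsMaximal) {x : S} (hx : x ∉ K) :
    ∃ t, 1 - t * x ∈ K := by
  have h : K ⊔ Ideal.span {x} = ⊤ := by
    apply hK.1.2
    refine lt_of_le_of_ne le_sup_left (fun h => hx ?_)
    rw [h]
    exact Ideal.mem_sup_right (Ideal.mem_span_singleton_self x)
  obtain ⟨k, hk, y, hy, hxy⟩ := Submodule.mem_sup.1 (h ▸ Submodule.mem_top : (1 : S) ∈ _)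
  obtain ⟨t, rfl⟩ := Ideal.mem_span_singleton'.1 hy
  refine ⟨t, ?_⟩
  rw [← hxy, add_sub_cancel_right]
  exact hk

theorem DD_of_HK {S : Type v} [Ring S] {n : ℕ} (h : HK S S n) : DD S n := by
  rw [HK_iff] at h
  obtain ⟨⟨K₀, hK₀⟩, hn⟩ := h
  choose K hKm hKle using fun i => Ideal.exists_le_maximal (K₀ i) (hK₀.1 i)
  have hK : CoInd K := hK₀.mono hKle (fun i => (hKm i).ne_top)
  have hs := small_of_max hK hn
  have hrad : ∀ x : S, x ∈ Ring.jacobson S ↔ ∀ k, x ∈ K k := by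
    intro x
    constructor
    · intro hx k
      have := hKm k
      exact Ring.jacobson_le_of_isMaximal (K k) hx
    · intro hx
      rw [Ring.jacobson_eq_sInf_isMaximal, Submodule.mem_sInf]
      intro (N : Ideal S) hN
      have hN' : N.IsMaximal := hN
      have hle : (⨅ i, K i) ≤ N := by
        by_contra hle
        apply hN'.ne_top
        apply hs
        rw [sup_comm]
        exact hN'.1.2 _ (left_lt_sup.2 hle)
      exact hle ((Submodule.mem_iInf _).2 hx)
  choose b hb1 hb2 using fun i => hK.2 i 1
  let π : S →+* S ⧸ Ring.jacobson S := Ideal.Quotient.mk _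
  have hπ : ∀ x, π x = 0 ↔ ∀ k, x ∈ K k := by
    intro x
    rw [← hrad]
    exact Ideal.Quotient.eq_zero_iff_mem
  have hsurj : Function.Surjective π := Ideal.Quotient.mk_surjective
  have hπe : ∀ x y, π x = π y ↔ ∀ k, x - y ∈ K k := by
    intro x y
    rw [← hπ, map_sub, sub_eq_zero]
  have hbn : ∀ i, b i ∉ K i := by
    intro i hi
    apply (hKm i).ne_top
    rw [Ideal.eq_top_iff_one]
    simpa using (K i).add_mem (hb1 i) hi
  have hidem : ∀ i, π (b i) * π (b i) = π (b i) := by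
    intro i
    rw [← map_mul, eq_comm, hπe]
    intro k
    by_cases hk : k = i
    · subst hk
      have := (K k).mul_mem_left (b k) (hb1 k)
      rwa [mul_sub, mul_one] at this
    · exact (K k).sub_mem (hb2 i k hk) ((K k).mul_mem_left _ (hb2 i k hk))
  have hstar : ∀ i (u : S ⧸ Ring.jacobson S), u ≠ 0 → u * π (b i) = u → ∃ s, s * u = π (b i) := by
    intro i u hu hue
    obtain ⟨U, rfl⟩ := hsurj u
    have h1 : U * b i ∉ K i := by
      intro h2
      apply hu
      rw [← hue, ← map_mul, hπ]
      intro k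
      by_cases hk : k = i
      · rw [hk]; exact h2
      · exact (K k).mul_mem_left _ (hb2 i k hk)
    obtain ⟨t, ht⟩ := maximal_inv (hKm i) h1
    refine ⟨π t, ?_⟩
    rw [← hue, ← map_mul, ← map_mul, eq_comm, hπe]
    intro k
    by_cases hk : k = i
    · subst hk
      have := (K k).sub_mem ht (hb1 k)
      have e : 1 - t * (U * b k) - (1 - b k) = b k - t * (U * b k) := by abel
      rwa [e] at this
    · exact (K k).sub_mem (hb2 i k hk)
        ((K k).mul_mem_left _ ((K k).mul_mem_left _ (hb2 i k hk)))
  refine ⟨S ⧸ Ring.jacobson S, inferInstance, π, fun i => π (b i), hsurj, ?_, ?_, hidem, ?_, ?_,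
    ?_, ?_⟩
  · intro s
    rw [← mem_moduleRad_iff]
    exact Ideal.Quotient.eq_zero_iff_mem
  · intro i h0
    exact hbn i ((hπ _).1 h0 i)
  · intro j i hji
    rw [← map_mul, hπ]
    intro k
    by_cases hk : k = i
    · subst hk
      have := (K k).sub_mem (hb2 j k hji.symm) ((K k).mul_mem_left (b j) (hb1 k))
      have e : b j - b j * (1 - b k) = b j * b k := by noncomm_ring
      rwa [e] at this
    · exact (K k).mul_mem_left _ (hb2 i k hk)
  · rw [← map_sum, ← map_one π, eq_comm, hπe]
    intro k
    rw [← Finset.add_sum_erase _ _ (Finset.mem_univ k), ← sub_sub]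
    refine (K k).sub_mem (hb1 k) (Submodule.sum_mem _ fun i hi => ?_)
    exact hb2 i k (Finset.ne_of_mem_erase hi).symm
  · intro x hx
    obtain ⟨x, rfl⟩ := hsurj x
    have h1 : ∃ k, x ∉ K k := by
      by_contra hno
      push Not at hno
      exact hx ((hπ x).2 hno)
    obtain ⟨k, hk⟩ := h1
    obtain ⟨t, ht⟩ := maximal_inv (hKm k) hk
    refine ⟨π t, fun h0 => ?_⟩
    rw [← map_mul, ← map_mul, hπ] at h0
    have h2 := (K k).mul_mem_left t (h0 k)
    have h3 := (K k).mul_mem_left (t * x) ht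
    have h4 := (K k).add_mem (K k |>.add_mem h2 h3) ht
    have e : t * (x * t * x) + t * x * (1 - t * x) + (1 - t * x) = 1 := by noncomm_ring
    rw [e] at h4
    exact (hKm k).ne_top ((Ideal.eq_top_iff_one _).2 h4)
  · intro i x hx
    set e := π (b i) with he
    have hee : e * e = e := hidem i
    have hee' : ∀ z, e * (e * z) = e * z := fun z => by rw [← mul_assoc, hee]
    have hene : e ≠ 0 := fun h0 => hbn i ((hπ _).1 h0 i)
    obtain ⟨s, hs⟩ := hstar i (e * x * e) hx (by rw [mul_assoc, hee])
    have hvu : e * s * e * (e * x * e) = e := by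
      calc e * s * e * (e * x * e) = e * (s * (e * x * e)) := by simp only [mul_assoc, hee']
        _ = e := by rw [hs, hee]
    have hv : e * s * e ≠ 0 := by
      intro h0
      rw [h0, zero_mul] at hvu
      exact hene hvu.symm
    obtain ⟨w, hw⟩ := hstar i (e * s * e) hv (by rw [mul_assoc, hee])
    have hu : e * x * e = w * e := by
      calc e * x * e = e * (e * x * e) := by simp only [mul_assoc, hee']
        _ = w * (e * s * e) * (e * x * e) := by rw [hw]
        _ = w * e := by rw [mul_assoc, hvu]
    refine ⟨s, ?_, ?_⟩
    · calc e * x * e * s * e = (e * x * e) * (e * s * e) := by simp only [mul_assoc, hee']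
        _ = w * (e * s * e) := by rw [hu]; simp only [mul_assoc, hee']
        _ = e := hw
    · calc e * s * e * x * e = e * s * e * (e * x * e) := by simp only [mul_assoc, hee']
        _ = e := hvu

theorem DD.ideals {S : Type v} [Ring S] {n : ℕ} (h : DD S n) :
    ∃ K : Fin n → Ideal S, CoInd K ∧ (∀ i, (K i).IsMaximal) ∧ (⨅ i, K i) = moduleRad S S := by
  obtain ⟨T, _, π, e, h⟩ := h
  let K : Fin n → Ideal S := fun i =>
    { carrier := {s | π s * e i = 0}
      add_mem' := fun {a b} ha hb => by
        change π (a + b) * e i = 0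
        rw [map_add, add_mul, ha, hb, add_zero]
      zero_mem' := by
        change π 0 * e i = 0
        rw [map_zero, zero_mul]
      smul_mem' := fun c a ha => by
        change π (c * a) * e i = 0
        rw [map_mul, mul_assoc, ha, mul_zero] }
  have hK : ∀ i s, s ∈ K i ↔ π s * e i = 0 := fun i s => Iff.rfl
  have hp : ∀ i, K i ≠ ⊤ := by
    intro i htop
    rw [Ideal.eq_top_iff_one, hK, map_one, one_mul] at htop
    exact h.ne i htop
  choose E hE using fun i => h.surj (e i)
  refine ⟨K, ⟨hp, fun i m => ⟨m * E i, ?_, fun j hj => ?_⟩⟩, fun i => ?_, ?_⟩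
  · rw [hK, map_sub, map_mul, hE, sub_mul, mul_assoc, h.idem, sub_self]
  · rw [hK, map_mul, hE, mul_assoc, h.orth i j hj.symm, mul_zero]
  · rw [Ideal.isMaximal_def]
    refine ⟨hp i, fun N hN => ?_⟩
    obtain ⟨x, hxN, hxK⟩ := SetLike.exists_of_lt hN
    rw [hK] at hxK
    obtain ⟨y, hy⟩ := h.semiprime _ hxK
    have h1 : e i * (y * π x) * e i ≠ 0 := by
      intro h0
      apply hy
      calc π x * e i * y * (π x * e i) = π x * (e i * (y * π x) * e i) := by
            simp only [mul_assoc]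
        _ = 0 := by rw [h0, mul_zero]
    obtain ⟨z, _, hz⟩ := h.corner i _ h1
    obtain ⟨t, ht⟩ := h.surj (e i * z * e i * y)
    have h2 : 1 - t * x ∈ K i := by
      rw [hK, map_sub, map_mul, ht, map_one, sub_mul, one_mul, sub_eq_zero]
      refine hz.symm.trans ?_
      simp only [mul_assoc]
    rw [Ideal.eq_top_iff_one]
    have h3 := N.add_mem (hN.le h2) (N.mul_mem_left t hxN)
    simpa using h3
  · ext s
    rw [mem_moduleRad_iff, ← h.ker, Submodule.mem_iInf]
    constructor
    · intro hs
      rw [← mul_one (π s), ← h.sum, Finset.mul_sum]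
      exact Finset.sum_eq_zero fun i _ => (hK i s).1 (hs i)
    · intro hs i
      rw [hK, hs, zero_mul]

theorem small_moduleRad (S : Type v) [Ring S] : IsSmallSubmodule S S (moduleRad S S) := by
  intro L hL
  obtain ⟨j, hj, l, hl, hjl⟩ := Submodule.mem_sup.1 (hL ▸ Submodule.mem_top : (1 : S) ∈ _)
  have h1 := (mem_moduleRad_iff j).1 hj (-1) 1
  have h2 : 1 + -1 * j * 1 = l := by
    rw [neg_one_mul, mul_one, ← hjl]; abel
  rw [h2] at h1
  exact Ideal.eq_top_of_isUnit_mem _ hl h1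

theorem HK_of_DD {S : Type v} [Ring S] {n : ℕ} (h : DD S n) : HK S S n := by
  obtain ⟨K, hK, hm, hr⟩ := h.ideals
  refine ⟨K, hK, fun i X Y hX hY hXY => ?_, hr ▸ small_moduleRad S⟩
  by_contra hno
  push Not at hno
  have h1 := (hm i).eq_of_le hno.1 hX
  have h2 := (hm i).eq_of_le hno.2 hY
  rw [← h1, ← h2, sup_idem] at hXY
  exact hK.1 i hXY

theorem DD_iff_HK {S : Type v} [Ring S] {n : ℕ} : DD S n ↔ HK S S n := ⟨HK_of_DD, DD_of_HK⟩

theorem HK_op_iff (S : Type v) [Ring S] (n : ℕ) : HK Sᵐᵒᵖ Sᵐᵒᵖ n ↔ HK S S n := by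
  rw [← DD_iff_HK, ← DD_iff_HK]
  exact ⟨DD.anti (RingEquiv.opOp S), DD.anti (RingEquiv.refl _)⟩

theorem DD.equiv {S : Type v} [Ring S] {n : ℕ} (h : DD S n) :
    ∃ K : Fin n → Ideal S, (∀ i, IsSimpleModule S (S ⧸ K i)) ∧
      Nonempty ((S ⧸ moduleRad S S) ≃ₗ[S] (∀ i, S ⧸ K i)) := by
  obtain ⟨K, hK, hm, hr⟩ := h.ideals
  refine ⟨K, fun i => isSimpleModule_iff_isCoatom.2 (hm i).1, ⟨?_⟩⟩
  rw [← hr, ← ker_pi_mkQ K]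
  exact LinearMap.quotKerEquivOfSurjective _ hK.pi_surjective

theorem DD.semilocal {S : Type v} [Ring S] {n : ℕ} (h : DD S n) : IsSemilocalModule S S := by
  obtain ⟨K, hs, ⟨f⟩⟩ := h.equiv
  exact IsSemisimpleModule.congr f

theorem DD.length {S : Type v} [Ring S] {n : ℕ} (h : DD S n) :
    ModuleLengthIs S (S ⧸ moduleRad S S) n := by
  obtain ⟨K, hs, ⟨f⟩⟩ := h.equiv
  have hl : Module.length S (S ⧸ moduleRad S S) = n := by
    rw [f.length_eq, Module.length_pi_of_fintype]
    simp
  have hfin : IsFiniteLength S (S ⧸ moduleRad S S) := by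
    rw [← Module.length_ne_top_iff, hl]
    exact ENat.natCast_ne_top n
  obtain ⟨s, h1, h2⟩ := isFiniteLength_iff_exists_compositionSeries.1 hfin
  refine ⟨s, h1, h2, ?_⟩
  have := Module.length_compositionSeries s h1 h2
  rw [hl] at this
  exact_mod_cast this

theorem exists_witness_of_semilocal {S : Type v} [Ring S] (h : IsSemilocalModule S S) :
    ∃ n, Nonempty (HollowDimWitness S S n) := by
  have : IsSemisimpleModule S (S ⧸ moduleRad S S) := h
  obtain ⟨n, N, f, hN⟩ := IsSemisimpleModule.exists_linearEquiv_fin_dfinsupp S (S ⧸ moduleRad S S)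
  let f' := f.trans (DFinsupp.linearEquivFunOnFintype (R := S) (M := fun i => N i))
  refine ⟨n, ⟨{
    H := fun i => N i
    g := f'.toLinearMap.comp (Submodule.mkQ (moduleRad S S))
    surj := ?_
    hollow := fun i => ?_
    small := ?_ }⟩⟩
  · exact f'.surjective.comp (Submodule.mkQ_surjective _)
  · have := hN i
    refine ⟨IsSimpleModule.nontrivial S _, fun L hL L' hL' => ?_⟩
    rcases eq_bot_or_eq_top L with h | h
    · rwa [h, bot_sup_eq] at hL'
    · exact absurd h hL
  · rw [LinearEquiv.ker_comp, Submodule.ker_mkQ]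
    exact small_moduleRad S

end Rings

/-- **Takeuchi.** A self-projective module `M` has finite hollow
dimension iff `S = End(M)` is semilocal, and then
`hdim M = hdim S = length (S/Jac S)`. -/
theorem selfProjective_hollowDim_iff_semilocal_endRing
    (R : Type u) [Ring R] (M : Type v) [AddCommGroup M] [Module R M]
    (hM : SelfProjective R M) :
    (HasFiniteHollowDim R M ↔
      IsSemilocalModule (Module.End R M) (Module.End R M)) ∧
    ∀ n : ℕ,
      (Nonempty (HollowDimWitness R M n) ↔
        Nonempty (HollowDimWitness (Module.End R M) (Module.End R M) n)) ∧
      (Nonempty (HollowDimWitness R M n) →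
        ModuleLengthIs (Module.End R M)
          (Module.End R M ⧸ moduleRad (Module.End R M) (Module.End R M)) n) := by
  have key : ∀ n, Nonempty (HollowDimWitness R M n) ↔
      Nonempty (HollowDimWitness (Module.End R M) (Module.End R M) n) := by
    intro n
    rw [witness_iff, witness_iff, HK_iff_op hM, HK_op_iff]
  refine ⟨⟨?_, ?_⟩, fun n => ⟨key n, fun h => ?_⟩⟩
  · rintro ⟨n, h⟩
    exact (DD_of_HK ((witness_iff n).1 ((key n).1 h))).semilocal
  · intro h
    obtain ⟨n, hn⟩ := exists_witness_of_semilocal h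
    exact ⟨n, (key n).2 hn⟩
  · exact (DD_of_HK ((witness_iff n).1 ((key n).1 h))).length
end

section
/- For a ring R the following are equivalent: (a) every principal left ideal Ra of R has a weak supplement in the left module _RR; (b) the quotient ring R/Jac(R) is von Neumann regular; (c) every principal right ideal aR of R has a weak supplement in the right module R_R. -/
universe u v w

theorem small_le_moduleRad {R : Type u} [Ring R] {M : Type v} [AddCommGroup M] [Module R M]
    {N : Submodule R M} (h : IsSmallSubmodule R M N) : N ≤ moduleRad R M := by
  refine le_sInf fun m hm => ?_
  by_contra hn
  apply hm.1
  apply h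
  rw [sup_comm]
  exact hm.2 _ (left_lt_sup.mpr hn)

theorem small_of_le_moduleRad {R : Type u} [Ring R] {M : Type v} [AddCommGroup M] [Module R M]
    [IsCoatomic (Submodule R M)]
    {N : Submodule R M} (h : N ≤ moduleRad R M) : IsSmallSubmodule R M N := by
  intro L hL
  rcases eq_top_or_exists_le_coatom L with h1 | ⟨m, hm, hLm⟩
  · exact h1
  · exact absurd (top_le_iff.mp (hL ▸ sup_le (h.trans (sInf_le hm)) hLm)) hm.1

theorem mem_rad_iff {R : Type u} [Ring R] (x : R) :
    x ∈ moduleRad R R ↔ ∀ y : R, ∃ z : R, z * (1 + y * x) = 1 := by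
  have : moduleRad R R = Ideal.jacobson (⊥ : Ideal R) := by
    rw [Ideal.jacobson_bot]; rfl
  rw [this, Ideal.mem_jacobson_iff]
  refine forall_congr' fun y => exists_congr fun z => ?_
  rw [Submodule.mem_bot, sub_eq_zero, mul_add, mul_one, mul_assoc, add_comm]

theorem rad_mul_right {R : Type u} [Ring R] {x : R} (hx : x ∈ moduleRad R R) (y : R) :
    x * y ∈ moduleRad R R :=
  Ideal.mul_mem_right (I := Ring.jacobson R) y hx

theorem rad_right_inv {R : Type u} [Ring R] {x : R} (hx : x ∈ moduleRad R R) (y : R) :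
    ∃ z : R, (1 + x * y) * z = 1 := by
  have hxy := rad_mul_right hx y
  obtain ⟨z, hz⟩ := (mem_rad_iff _).1 hxy 1
  rw [one_mul] at hz
  obtain ⟨w, hw⟩ := (mem_rad_iff _).1 hxy (-z)
  have e : 1 + -z * (x * y) = z := by
    rw [mul_add, mul_one] at hz
    rw [← hz]; noncomm_ring
  rw [e] at hw
  refine ⟨z, ?_⟩
  rwa [← left_inv_eq_right_inv hw hz]

theorem mem_rad_op_iff {R : Type u} [Ring R] (x : R) :
    MulOpposite.op x ∈ moduleRad Rᵐᵒᵖ Rᵐᵒᵖ ↔ x ∈ moduleRad R R := by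
  constructor
  · intro h
    rw [mem_rad_iff]
    intro y
    obtain ⟨z, hz⟩ := rad_right_inv h (MulOpposite.op y)
    exact ⟨z.unop, by simpa using congrArg MulOpposite.unop hz⟩
  · intro h
    rw [mem_rad_iff]
    intro y
    obtain ⟨z, hz⟩ := rad_right_inv h y.unop
    exact ⟨MulOpposite.op z, MulOpposite.unop_injective (by simpa using hz)⟩

/-- `op` as a right-linear map. -/
def opRight (R : Type u) [Ring R] : R →ₗ[Rᵐᵒᵖ] Rᵐᵒᵖ where
  toFun := MulOpposite.op
  map_add' _ _ := rfl
  map_smul' _ _ := rfl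

theorem opRight_bijective (R : Type u) [Ring R] : Function.Bijective (opRight R) :=
  MulOpposite.op_bijective

theorem mem_rad_right_iff {R : Type u} [Ring R] (x : R) :
    x ∈ moduleRad Rᵐᵒᵖ R ↔ x ∈ moduleRad R R := by
  rw [← mem_rad_op_iff]
  have h := Module.comap_jacobson_of_bijective (opRight_bijective R)
  change x ∈ Module.jacobson Rᵐᵒᵖ R ↔ _
  rw [← h]; rfl

theorem right_finite (R : Type u) [Ring R] : Module.Finite Rᵐᵒᵖ R :=
  Module.Finite.equiv (LinearEquiv.ofBijective (opRight R) (opRight_bijective R)).symm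

/-- Every principal left ideal of `R` has a weak supplement in
`_RR` iff `R/Jac R` is von Neumann regular, iff every principal right ideal has a
weak supplement in `R_R`.  (Von Neumann regularity of `R/Jac R` is expressed
elementwise: for each `a` there is `b` with `a - aba ∈ Jac R`.) -/
theorem principal_weak_supplements_iff_vnr_mod_jacobson
    (R : Type u) [Ring R] :
    ((∀ a : R, ∃ L : Submodule R R,
        IsWeakSupplement R R (Submodule.span R {a}) L) ↔
      (∀ a : R, ∃ b : R, a - a * b * a ∈ moduleRad R R)) ∧
    ((∀ a : R, ∃ b : R, a - a * b * a ∈ moduleRad R R) ↔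
      (∀ a : R, ∃ L : Submodule Rᵐᵒᵖ R,
        IsWeakSupplement Rᵐᵒᵖ R (Submodule.span Rᵐᵒᵖ {a}) L)) := by
  have rad_left : ∀ (r : R) {x : R}, x ∈ moduleRad R R → r * x ∈ moduleRad R R :=
    fun r x hx => (moduleRad R R).smul_mem r hx
  refine ⟨⟨fun H a => ?_, fun H a => ?_⟩, ⟨fun H a => ?_, fun H a => ?_⟩⟩
  · obtain ⟨L, h1, h2⟩ := H a
    obtain ⟨n, hn, l, hl, e⟩ := Submodule.mem_sup.1 (h1 ▸ Submodule.mem_top : (1 : R) ∈ _)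
    obtain ⟨r, rfl⟩ := Submodule.mem_span_singleton.1 hn
    rw [smul_eq_mul] at e
    refine ⟨r, small_le_moduleRad h2 ⟨?_, ?_⟩⟩
    · exact Submodule.mem_span_singleton.2 ⟨1 - a * r, by simp only [smul_eq_mul]; noncomm_ring⟩
    · have : a - a * r * a = a • l := by
        rw [smul_eq_mul, eq_sub_of_add_eq' e]; noncomm_ring
      rw [this]; exact L.smul_mem _ hl
  · obtain ⟨b, hb⟩ := H a
    refine ⟨Submodule.span R {1 - b * a}, ?_, small_of_le_moduleRad ?_⟩
    · refine (Ideal.eq_top_iff_one _).2 (Submodule.mem_sup.2 ⟨b * a, ?_, 1 - b * a, ?_, by simp⟩)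
      · exact Submodule.mem_span_singleton.2 ⟨b, rfl⟩
      · exact Submodule.mem_span_singleton_self _
    · rintro x ⟨hx, hy⟩
      obtain ⟨r, hr⟩ := Submodule.mem_span_singleton.1 hx
      obtain ⟨s, hs⟩ := Submodule.mem_span_singleton.1 hy
      rw [smul_eq_mul] at hr hs
      have e : x = r * (a - a * b * a) + s * b * (a - a * b * a) := by
        calc x = (x - x * b * a) + x * b * a := by noncomm_ring
          _ = (r * a - r * a * b * a) + s * (1 - b * a) * b * a := by rw [hr, hs]
          _ = _ := by noncomm_ring
      rw [e]
      exact add_mem (rad_left _ hb) (rad_left _ hb)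
  · obtain ⟨b, hb⟩ := H a
    haveI := right_finite R
    refine ⟨Submodule.span Rᵐᵒᵖ {1 - a * b}, ?_, small_of_le_moduleRad ?_⟩
    · rw [eq_top_iff]
      rintro x -
      refine Submodule.mem_sup.2 ⟨a * (b * x), ?_, (1 - a * b) * x, ?_, by noncomm_ring⟩
      · exact Submodule.mem_span_singleton.2 ⟨MulOpposite.op (b * x), rfl⟩
      · exact Submodule.mem_span_singleton.2 ⟨MulOpposite.op x, rfl⟩
    · rintro x ⟨hx, hy⟩
      obtain ⟨r, hr⟩ := Submodule.mem_span_singleton.1 hx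
      obtain ⟨s, hs⟩ := Submodule.mem_span_singleton.1 hy
      rw [MulOpposite.smul_eq_mul_unop] at hr hs
      rw [mem_rad_right_iff]
      have e : x = (a - a * b * a) * r.unop + (a - a * b * a) * (b * s.unop) := by
        calc x = (x - a * b * x) + a * b * x := by noncomm_ring
          _ = (a * r.unop - a * b * (a * r.unop)) + a * b * ((1 - a * b) * s.unop) := by
            rw [hr, hs]
          _ = _ := by noncomm_ring
      rw [e]
      exact add_mem (rad_mul_right hb _) (rad_mul_right hb _)
  · obtain ⟨L, h1, h2⟩ := H a
    obtain ⟨n, hn, l, hl, e⟩ := Submodule.mem_sup.1 (h1 ▸ Submodule.mem_top : (1 : R) ∈ _)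
    obtain ⟨r, rfl⟩ := Submodule.mem_span_singleton.1 hn
    rw [MulOpposite.smul_eq_mul_unop] at e
    refine ⟨r.unop, (mem_rad_right_iff _).1 (small_le_moduleRad h2 ⟨?_, ?_⟩)⟩
    · refine Submodule.mem_span_singleton.2 ⟨MulOpposite.op (1 - r.unop * a), ?_⟩
      rw [MulOpposite.smul_eq_mul_unop, MulOpposite.unop_op]; noncomm_ring
    · have : a - a * r.unop * a = MulOpposite.op a • l := by
        rw [MulOpposite.smul_eq_mul_unop, MulOpposite.unop_op, eq_sub_of_add_eq' e]; noncomm_ring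
      rw [this]; exact L.smul_mem _ hl
end
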